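/- Let R be a ring, b a central element, and x, y elements with x*y - y*x = b. Then for all natural numbers n: (x+y)^n = sum over i from 0 to n of E(n,i) * x^i * y^(n-i) plus lower terms; precisely, writing (x+y)^n in the PBW form sum over pairs (i,k) with i + 2k ≤ n of E(n;i,k) * x^i * y^(n-i-2k) * b^k, one has E(n;i,k) = (-1)^k * n! / (i! * (n-i-2k)! * k! * 2^k). -/

import Mathlib

/-- The summand `x ^ i * y ^ j * b ^ k` with `i + j + 2 * k = n`, divided by
`i! * j! * k! * (-2) ^ k`; it is zero when no such `j` exists. -/
def weylTerm {R : Type*} [Ring R] [Algebra ℚ R] (x y b : R) (n i k : ℕ) : R :=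
  if i + 2 * k ≤ n then
    ((-1 : ℚ) ^ k / ((i.factorial : ℚ) * ((n - i - 2 * k).factorial : ℚ) *
      (k.factorial : ℚ) * 2 ^ k)) • (x ^ i * y ^ (n - i - 2 * k) * b ^ k)
  else 0

section WeylTerm

variable {R : Type*} [Ring R] [Algebra ℚ R] {x y b : R}

theorem weylTerm_of_lt {n i k : ℕ} (h : n < i + 2 * k) : weylTerm x y b n i k = 0 :=
  if_neg (by lia)

theorem weylTerm_add (i j k : ℕ) :
    weylTerm x y b (i + j + 2 * k) i k =
      ((-1 : ℚ) ^ k / ((i.factorial : ℚ) * (j.factorial : ℚ) * (k.factorial : ℚ) * 2 ^ k)) •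
        (x ^ i * y ^ j * b ^ k) := by
  have hj : i + j + 2 * k - i - 2 * k = j := by lia
  rw [weylTerm, if_pos (by lia), hj]

theorem mul_pow_succ_of_commutator_central (hbc : ∀ r : R, b * r = r * b)
    (h : x * y - y * x = b) (i : ℕ) :
    y * x ^ (i + 1) = x ^ (i + 1) * y - ((i : ℚ) + 1) • (x ^ i * b) := by
  have hyx : y * x = x * y - b := by rw [← h]; abel
  induction i with
  | zero => simp [hyx]
  | succ i ih =>
    rw [pow_succ, ← mul_assoc, ih, sub_mul, mul_assoc, hyx, smul_mul_assoc, mul_assoc (x ^ i),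
      hbc x, ← mul_assoc (x ^ i), ← pow_succ, mul_sub, ← mul_assoc]
    push_cast
    module

theorem left_mul_weylTerm (n i k : ℕ) :
    x * weylTerm x y b n i k = ((i : ℚ) + 1) • weylTerm x y b (n + 1) (i + 1) k := by
  rcases lt_or_ge n (i + 2 * k) with hn | hn
  · rw [weylTerm_of_lt hn, weylTerm_of_lt (by lia), mul_zero, smul_zero]
  obtain ⟨j, rfl⟩ : ∃ j, n = i + j + 2 * k := ⟨n - i - 2 * k, by lia⟩
  rw [show i + j + 2 * k + 1 = (i + 1) + j + 2 * k by lia, weylTerm_add, weylTerm_add,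
    mul_smul_comm, smul_smul, ← mul_assoc, ← mul_assoc, ← pow_succ', Nat.factorial_succ]
  congr 1
  push_cast
  field_simp

theorem smul_pow_mul_pow_succ_mul_pow (i j k : ℕ) :
    ((-1 : ℚ) ^ k / ((i.factorial : ℚ) * (j.factorial : ℚ) * (k.factorial : ℚ) * 2 ^ k)) •
        (x ^ i * y ^ (j + 1) * b ^ k) =
      ((j : ℚ) + 1) • weylTerm x y b (i + j + 2 * k + 1) i k := by
  rw [show i + j + 2 * k + 1 = i + (j + 1) + 2 * k by lia, weylTerm_add, smul_smul,
    Nat.factorial_succ]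
  congr 1
  push_cast
  field_simp

theorem right_mul_weylTerm_zero (n k : ℕ) :
    y * weylTerm x y b n 0 k = ((n : ℚ) + 1 - 2 * k) • weylTerm x y b (n + 1) 0 k := by
  rcases lt_or_ge n (2 * k) with hn | hn
  · rw [weylTerm_of_lt (by lia), mul_zero]
    rcases Nat.lt_or_ge (n + 1) (2 * k) with hn' | hn'
    · rw [weylTerm_of_lt (by lia), smul_zero]
    · have hc : (n : ℚ) + 1 - 2 * k = 0 := by
        rw [sub_eq_zero]
        exact_mod_cast (show n + 1 = 2 * k by lia)
      rw [hc, zero_smul]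
  obtain ⟨j, rfl⟩ : ∃ j, n = 0 + j + 2 * k := ⟨n - 2 * k, by lia⟩
  have hc : ((0 + j + 2 * k : ℕ) : ℚ) + 1 - 2 * k = j + 1 := by push_cast; ring
  rw [hc, ← smul_pow_mul_pow_succ_mul_pow, weylTerm_add, mul_smul_comm, pow_zero, one_mul, one_mul,
    ← mul_assoc, ← pow_succ']

theorem right_mul_weylTerm_succ (hbc : ∀ r : R, b * r = r * b) (h : x * y - y * x = b)
    (n i k : ℕ) :
    y * weylTerm x y b n (i + 1) k =
      ((n : ℚ) + 1 - (i + 1 : ℕ) - 2 * k) • weylTerm x y b (n + 1) (i + 1) k +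
        (2 * ((k + 1 : ℕ) : ℚ)) • weylTerm x y b (n + 1) i (k + 1) := by
  rcases lt_or_ge n (i + 1 + 2 * k) with hn | hn
  · rw [weylTerm_of_lt hn, weylTerm_of_lt (show n + 1 < i + 2 * (k + 1) by lia)]
    rcases Nat.lt_or_ge (n + 1) (i + 1 + 2 * k) with hn' | hn'
    · simp [weylTerm_of_lt hn']
    · have hc : (n : ℚ) + 1 - (i + 1 : ℕ) - 2 * k = 0 := by
        have : n = i + 2 * k := by lia
        subst this; push_cast; ring
      rw [hc, zero_smul, mul_zero, smul_zero, add_zero]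
  obtain ⟨j, rfl⟩ : ∃ j, n = (i + 1) + j + 2 * k := ⟨n - (i + 1) - 2 * k, by lia⟩
  have hc : ((i + 1 + j + 2 * k : ℕ) : ℚ) + 1 - (i + 1 : ℕ) - 2 * k = j + 1 := by
    push_cast; ring
  have hb : x ^ i * b * y ^ j * b ^ k = x ^ i * y ^ j * b ^ (k + 1) := by
    rw [mul_assoc (x ^ i), hbc, ← mul_assoc, mul_assoc _ b, ← pow_succ']
  rw [hc, ← smul_pow_mul_pow_succ_mul_pow, show i + 1 + j + 2 * k + 1 = i + j + 2 * (k + 1) by lia,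
    weylTerm_add, weylTerm_add, mul_smul_comm, ← mul_assoc, ← mul_assoc,
    mul_pow_succ_of_commutator_central hbc h, sub_mul, sub_mul, mul_assoc _ y, ← pow_succ',
    smul_mul_assoc, smul_mul_assoc, hb, smul_sub, smul_smul, smul_smul, sub_eq_add_neg,
    ← neg_smul]
  congr 2
  rw [Nat.factorial_succ, Nat.factorial_succ]
  push_cast
  field_simp
  ring

theorem sum_range_eq_of_shift {M : Type*} [AddCommMonoid M] {f g : ℕ → M} {N : ℕ}
    (h0 : g 0 = 0) (hN : f N = 0) (hs : ∀ i, f i = g (i + 1)) :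
    ∑ i ∈ Finset.range (N + 1), f i = ∑ i ∈ Finset.range (N + 1), g i := by
  rw [Finset.sum_range_succ, Finset.sum_range_succ', h0, hN]
  simp [hs]

theorem left_mul_sum_weylTerm {n N : ℕ} (hN : n < N) :
    x * ∑ i ∈ Finset.range (N + 1), ∑ k ∈ Finset.range (N + 1), weylTerm x y b n i k =
      ∑ i ∈ Finset.range (N + 1), ∑ k ∈ Finset.range (N + 1),
        (i : ℚ) • weylTerm x y b (n + 1) i k := by
  simp only [Finset.mul_sum]
  refine sum_range_eq_of_shift (by simp) ?_ fun i => ?_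
  · exact Finset.sum_eq_zero fun k _ => by rw [weylTerm_of_lt (by lia), mul_zero]
  · exact Finset.sum_congr rfl fun k _ => by rw [left_mul_weylTerm, Nat.cast_succ]

theorem right_mul_sum_weylTerm (hbc : ∀ r : R, b * r = r * b) (h : x * y - y * x = b)
    {n N : ℕ} (hN : n < N) :
    y * ∑ i ∈ Finset.range (N + 1), ∑ k ∈ Finset.range (N + 1), weylTerm x y b n i k =
      ∑ i ∈ Finset.range (N + 1), ∑ k ∈ Finset.range (N + 1),
        ((n : ℚ) + 1 - i) • weylTerm x y b (n + 1) i k := by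
  have hlower (i : ℕ) :
      ∑ k ∈ Finset.range (N + 1), (2 * ((k + 1 : ℕ) : ℚ)) • weylTerm x y b (n + 1) i (k + 1) =
        ∑ k ∈ Finset.range (N + 1), (2 * (k : ℚ)) • weylTerm x y b (n + 1) i k :=
    sum_range_eq_of_shift (g := fun k => (2 * (k : ℚ)) • weylTerm x y b (n + 1) i k) (by simp)
      (by rw [weylTerm_of_lt (by lia), smul_zero]) fun _ => rfl
  have htop :
      ∑ k ∈ Finset.range (N + 1), (2 * (k : ℚ)) • weylTerm x y b (n + 1) N k = 0 := by
    refine Finset.sum_eq_zero fun k _ => ?_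
    rcases Nat.eq_zero_or_pos k with rfl | hk
    · simp
    · rw [weylTerm_of_lt (by lia), smul_zero]
  simp only [Finset.mul_sum]
  rw [Finset.sum_range_succ']
  simp only [right_mul_weylTerm_succ hbc h, right_mul_weylTerm_zero, Finset.sum_add_distrib,
    hlower]
  rw [add_right_comm, ← add_zero (∑ i ∈ Finset.range N, ∑ k ∈ Finset.range (N + 1),
    (2 * (k : ℚ)) • weylTerm x y b (n + 1) i k), ← htop, ← Finset.sum_range_succ]
  have hzero : ∑ k ∈ Finset.range (N + 1), ((n : ℚ) + 1 - 2 * k) • weylTerm x y b (n + 1) 0 k =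
      ∑ k ∈ Finset.range (N + 1),
        ((n : ℚ) + 1 - (0 : ℕ) - 2 * k) • weylTerm x y b (n + 1) 0 k := by simp
  rw [hzero, ← Finset.sum_range_succ' fun i => ∑ k ∈ Finset.range (N + 1),
    ((n : ℚ) + 1 - i - 2 * k) • weylTerm x y b (n + 1) i k]
  simp only [← Finset.sum_add_distrib, ← add_smul, sub_add_cancel]

theorem add_pow_eq_factorial_smul_sum_weylTerm (hbc : ∀ r : R, b * r = r * b)
    (h : x * y - y * x = b) (n N : ℕ) (hN : n ≤ N) :
    (x + y) ^ n = (n.factorial : ℚ) •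
      ∑ i ∈ Finset.range (N + 1), ∑ k ∈ Finset.range (N + 1), weylTerm x y b n i k := by
  induction n with
  | zero =>
    rw [Finset.sum_eq_single_of_mem 0 (by simp), Finset.sum_eq_single_of_mem 0 (by simp)]
    · simp [weylTerm]
    · exact fun k _ hk => weylTerm_of_lt (by lia)
    · exact fun i _ hi => Finset.sum_eq_zero fun k _ => weylTerm_of_lt (by lia)
  | succ n ih =>
    rw [pow_succ', ih (by lia), mul_smul_comm, add_mul, left_mul_sum_weylTerm hN,
      right_mul_sum_weylTerm hbc h hN, Nat.factorial_succ, mul_comm, Nat.cast_mul, mul_smul]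
    simp only [← Finset.sum_add_distrib, ← add_smul, add_sub_cancel, ← Finset.smul_sum,
      Nat.cast_succ]

end WeylTerm

theorem binomial_weyl_const_closed {R : Type*} [Ring R] [Algebra ℚ R] (x y b : R)
    (hbc : ∀ r : R, b * r = r * b)
    (h : x * y - y * x = b) :
    ∀ n : ℕ,
      (x + y) ^ n =
        ∑ i ∈ Finset.range (n + 1), ∑ k ∈ Finset.range (n + 1),
          if i + 2 * k ≤ n then
            (((-1 : ℚ) ^ k * (n.factorial : ℚ) /
              ((i.factorial : ℚ) * ((n - i - 2 * k).factorial : ℚ) *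
                (k.factorial : ℚ) * 2 ^ k)) •
              (x ^ i * y ^ (n - i - 2 * k) * b ^ k))
          else 0 := by
  intro n
  rw [add_pow_eq_factorial_smul_sum_weylTerm hbc h n n le_rfl]
  simp only [Finset.smul_sum, weylTerm, smul_ite, smul_zero, smul_smul, mul_div_assoc', mul_comm]
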